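/- arXiv:0903.2545 — 3 statements merged into one kernel-verified Lean document; each statement's English description precedes it below -/
import Mathlib

section
/- Let q ≥ 3 be an odd natural number and consider the polynomial P(u) = q⁴·(1 − u)^{2q} − (1 − u)^{q+1} + (q⁴ − 1)·(1 − u)^{q} − (1 − u)^{q−1} + q⁴ in ℤ[u]. Then the coefficient of u^{2q} in P is odd; in particular, P is not divisible by 2 in ℤ[u]. -/
open Polynomial

theorem natDegree_one_sub_X_pow_le (n : ℕ) : ((1 - X : ℤ[X]) ^ n).natDegree ≤ n := by
  compute_degree

theorem coeff_one_sub_X_pow_self (n : ℕ) : ((1 - X : ℤ[X]) ^ n).coeff n = (-1) ^ n := by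
  have h := coeff_pow_of_natDegree_le (p := (1 - X : ℤ[X])) (m := n) (n := 1) (by compute_degree)
  simpa [coeff_one] using h

theorem coeff_one_sub_X_pow_of_lt {n k : ℕ} (h : n < k) : ((1 - X : ℤ[X]) ^ n).coeff k = 0 :=
  coeff_eq_zero_of_natDegree_lt ((natDegree_one_sub_X_pow_le n).trans_lt h)

/-- For odd `q ≥ 3`, the coefficient of `u^(2q)` in
`P(u) = q⁴(1−u)^{2q} − (1−u)^{q+1} + (q⁴−1)(1−u)^q − (1−u)^{q−1} + q⁴`
is odd; in particular `P` is not divisible by `2` in `ℤ[u]`. -/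
theorem coeff_odd_and_not_two_dvd (q : ℕ) (hq : 3 ≤ q) (hqodd : Odd q)
    (P : Polynomial ℤ)
    (hP : P = C ((q : ℤ) ^ 4) * (1 - X) ^ (2 * q)
        - (1 - X) ^ (q + 1)
        + C ((q : ℤ) ^ 4 - 1) * (1 - X) ^ q
        - (1 - X) ^ (q - 1)
        + C ((q : ℤ) ^ 4)) :
    Odd (P.coeff (2 * q)) ∧ ¬ (2 : Polynomial ℤ) ∣ P := by
  have hcoeff : P.coeff (2 * q) = (q : ℤ) ^ 4 := by
    simp only [hP, coeff_add, coeff_sub, coeff_C_mul]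
    rw [coeff_one_sub_X_pow_self, coeff_one_sub_X_pow_of_lt (by omega : q + 1 < 2 * q),
      coeff_one_sub_X_pow_of_lt (by omega : q < 2 * q),
      coeff_one_sub_X_pow_of_lt (by omega : q - 1 < 2 * q),
      coeff_C_of_ne_zero (by omega : 2 * q ≠ 0), (even_two_mul q).neg_one_pow]
    ring
  have hodd : Odd (P.coeff (2 * q)) := by
    rw [hcoeff]
    exact ((Int.odd_coe_nat q).mpr hqodd).pow
  refine ⟨hodd, fun hdvd => Int.not_even_iff_odd.mpr hodd (even_iff_two_dvd.mpr ?_)⟩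
  exact C_dvd_iff_dvd_coeff 2 P |>.mp hdvd (2 * q)
end

section
/- Let A and B be finitely generated abelian groups and let f : A → B be a group homomorphism. Suppose there exists r₀ ≥ 1 such that for every r ≥ r₀: (i) the induced homomorphism A/2ʳA → B/2ʳB is injective, and (ii) f maps the subgroup A[2ʳ] = {a ∈ A : 2ʳ·a = 0} onto B[2ʳ] = {b ∈ B : 2ʳ·b = 0}. Then f restricts to a bijection from the 2-primary torsion subgroup of A onto the 2-primary torsion subgroup of B. -/
/-- In a finitely generated abelian group, the `p`-power torsion has bounded exponent. -/
theorem AddGroup.FG.exists_pow_nsmul_eq_zero (A : Type*) [AddCommGroup A] [AddGroup.FG A]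
    (p : ℕ) : ∃ N : ℕ, ∀ (n : ℕ) (a : A), p ^ n • a = 0 → p ^ N • a = 0 := by
  have : Module.Finite ℤ A := Module.Finite.iff_addGroup_fg.mpr inferInstance
  have hmono : Monotone fun n : ℕ => Submodule.torsionBy ℤ A ((p : ℤ) ^ n) := fun m n hmn =>
    Submodule.torsionBy_le_torsionBy_of_dvd _ _ (pow_dvd_pow _ hmn)
  obtain ⟨N, hN⟩ := monotone_stabilizes_iff_noetherian.mpr
    (inferInstance : IsNoetherian ℤ A) ⟨_, hmono⟩
  have mem_iff (n : ℕ) (a : A) :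
      a ∈ Submodule.torsionBy ℤ A ((p : ℤ) ^ n) ↔ p ^ n • a = 0 := by
    rw [Submodule.mem_torsionBy_iff, ← natCast_zsmul, Nat.cast_pow]
  refine ⟨N, fun n a ha => (mem_iff N a).mp ?_⟩
  have hle := hmono (le_max_right N n) ((mem_iff n a).mpr ha)
  exact (hN (max N n) (le_max_left N n)).ge hle

/-- Let `f : A → B` be a homomorphism of finitely generated abelian groups.
If there is `r₀ ≥ 1` such that for all `r ≥ r₀` the induced map
`A/2ʳA → B/2ʳB` is injective (i.e. `f a ∈ 2ʳB → a ∈ 2ʳA`) and `f` maps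
`A[2ʳ]` onto `B[2ʳ]`, then `f` restricts to a bijection from the 2-primary
torsion subgroup of `A` onto the 2-primary torsion subgroup of `B`. -/
theorem bijOn_two_primary_torsion (A B : Type*) [AddCommGroup A]
    [AddCommGroup B] [AddGroup.FG A] [AddGroup.FG B] (f : A →+ B)
    (h : ∃ r₀ : ℕ, 1 ≤ r₀ ∧ ∀ r : ℕ, r₀ ≤ r →
      (∀ a : A, (∃ b : B, f a = (2 ^ r : ℕ) • b) →
        ∃ a' : A, a = (2 ^ r : ℕ) • a') ∧
      (∀ b : B, (2 ^ r : ℕ) • b = 0 →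
        ∃ a : A, (2 ^ r : ℕ) • a = 0 ∧ f a = b)) :
    Set.BijOn (⇑f) {a : A | ∃ k : ℕ, (2 ^ k : ℕ) • a = 0}
      {b : B | ∃ k : ℕ, (2 ^ k : ℕ) • b = 0} := by
  obtain ⟨r₀, -, h⟩ := h
  obtain ⟨N, hN⟩ := AddGroup.FG.exists_pow_nsmul_eq_zero A 2
  refine ⟨?_, ?_, ?_⟩
  · rintro a ⟨k, hk⟩
    exact ⟨k, by rw [← map_nsmul, hk, map_zero]⟩
  · rintro x ⟨k, hk⟩ y ⟨l, hl⟩ hxy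
    have hsub : 2 ^ (k + l) • (x - y) = 0 := by
      rw [nsmul_sub, pow_add, mul_nsmul, hk, mul_nsmul', hl, nsmul_zero, nsmul_zero, sub_zero]
    obtain ⟨c, hc⟩ := (h (max r₀ N) (le_max_left _ _)).1 (x - y)
      ⟨0, by rw [map_sub, hxy, sub_self, nsmul_zero]⟩
    have hcN : 2 ^ N • c = 0 := by
      refine hN (max r₀ N + (k + l)) c ?_
      rw [pow_add, mul_nsmul, ← hc, hsub]
    obtain ⟨d, hd⟩ := pow_dvd_pow 2 (le_max_right r₀ N)
    rw [← sub_eq_zero, hc, hd, mul_nsmul, hcN, nsmul_zero]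
  · rintro b ⟨k, hk⟩
    obtain ⟨d, hd⟩ := pow_dvd_pow 2 (le_max_right r₀ k)
    obtain ⟨a, ha, hab⟩ := (h (max r₀ k) (le_max_left _ _)).2 b
      (by rw [hd, mul_nsmul, hk, nsmul_zero])
    exact ⟨a, ⟨_, ha⟩, hab⟩
end

section
/- Let A and B be finitely generated abelian groups and let f : A → B be a group homomorphism. Suppose there exists r₀ ≥ 1 such that for every r ≥ r₀ the induced homomorphism A/2ʳA → B/2ʳB is injective and f maps A[2ʳ] = {a ∈ A : 2ʳ·a = 0} onto B[2ʳ] = {b ∈ B : 2ʳ·b = 0}; suppose moreover that the induced map A ⊗_ℤ ℚ → B ⊗_ℤ ℚ is bijective. Then the kernel of f and the cokernel B/f(A) are both finite groups of odd order. -/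
open TensorProduct

/-- A finitely generated abelian group in which every element is torsion and no nonzero element
is killed by `2` is finite of odd order. -/
theorem odd_natCard_of_torsion_of_two_torsion_free {G : Type*} [AddCommGroup G] [Module.Finite ℤ G]
    (htors : ∀ x : G, ∃ n : ℤ, n ≠ 0 ∧ n • x = 0) (htwo : ∀ x : G, 2 • x = 0 → x = 0) :
    Odd (Nat.card G) := by
  have : Finite G := Module.finite_of_fg_torsion G fun {x} ↦ by
    obtain ⟨n, hn, hx⟩ := htors x
    exact ⟨⟨n, mem_nonZeroDivisors_of_ne_zero hn⟩, hx⟩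
  rw [← Nat.not_even_iff_odd, even_iff_two_dvd]
  intro hdvd
  obtain ⟨x, hx⟩ := exists_prime_addOrderOf_dvd_card' (G := G) 2 hdvd
  have hx0 : x = 0 := htwo x (hx ▸ addOrderOf_nsmul_eq_zero x)
  simp [hx0] at hx

/-- An element of a finitely generated abelian group that is divisible by all large powers of `2`
is fixed by multiplication by some even integer. -/
theorem exists_even_smul_eq_self {A : Type*} [AddCommGroup A] [Module.Finite ℤ A] (a : A) (r₀ : ℕ)
    (ha : ∀ r, r₀ ≤ r → ∃ a' : A, a = (2 ^ r : ℕ) • a') : ∃ c : ℤ, (c * 2) • a = a := by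
  have hmem : a ∈ (⨅ i : ℕ, Ideal.span {(2 : ℤ)} ^ i • ⊤ : Submodule ℤ A) := by
    rw [Submodule.mem_iInf]
    intro i
    obtain ⟨a', ha'⟩ := ha (max i r₀) (le_max_right _ _)
    have hle := Ideal.pow_le_pow_right (I := Ideal.span {(2 : ℤ)}) (le_max_left i r₀)
    refine Submodule.smul_mono_left hle ?_
    have : a = (2 ^ max i r₀ : ℤ) • a' := by
      rw [ha', ← natCast_zsmul]; push_cast; rfl
    rw [this]
    exact Submodule.smul_mem_smul
      (Ideal.pow_mem_pow (Ideal.mem_span_singleton_self 2) _) Submodule.mem_top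
  obtain ⟨⟨s, hs⟩, hsa⟩ := (Ideal.mem_iInf_smul_pow_eq_bot_iff _ a).1 hmem
  obtain ⟨c, rfl⟩ := Ideal.mem_span_singleton'.1 hs
  exact ⟨c, hsa⟩

/-- If `f ⊗ ℚ` is surjective then every element of the target has a nonzero multiple in the
range of `f`. -/
theorem exists_smul_mem_range_of_rTensor_rat_surjective {M N : Type*} [AddCommGroup M]
    [AddCommGroup N] (f : M →ₗ[ℤ] N) (hf : Function.Surjective (f.rTensor ℚ)) (y : N) :
    ∃ n : ℤ, n ≠ 0 ∧ n • y ∈ LinearMap.range f := by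
  have hzero : (1 : ℚ) ⊗ₜ[ℤ] (LinearMap.range f).mkQ y = 0 := by
    obtain ⟨z, hz⟩ := hf (y ⊗ₜ 1)
    have hcomp : (LinearMap.range f).mkQ ∘ₗ f = 0 := LinearMap.range_mkQ_comp f
    have := congrArg ((LinearMap.range f).mkQ.rTensor ℚ) hz
    rw [← LinearMap.comp_apply, ← LinearMap.rTensor_comp, hcomp, LinearMap.rTensor_zero,
      LinearMap.zero_apply, LinearMap.rTensor_tmul] at this
    simpa using congrArg (TensorProduct.comm ℤ _ ℚ) this.symm
  obtain ⟨⟨n, hn⟩, hny⟩ := (IsLocalizedModule.eq_zero_iff (nonZeroDivisors ℤ)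
    (TensorProduct.mk ℤ ℚ (N ⧸ LinearMap.range f) 1)).1 hzero
  refine ⟨n, nonZeroDivisors.ne_zero hn, ?_⟩
  rw [← Submodule.Quotient.mk_eq_zero]
  exact hny

/-- Let `f : A → B` be a homomorphism of finitely generated abelian groups.
If there is `r₀ ≥ 1` such that for all `r ≥ r₀` the induced map
`A/2ʳA → B/2ʳB` is injective and `f` maps `A[2ʳ]` onto `B[2ʳ]`, and if
moreover the induced map `A ⊗ ℚ → B ⊗ ℚ` is bijective, then the kernel and
the cokernel of `f` are finite groups of odd order. -/
theorem ker_coker_odd_of_mod_two_pow_iso (A B : Type*) [AddCommGroup A]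
    [AddCommGroup B] [AddGroup.FG A] [AddGroup.FG B] (f : A →+ B)
    (h : ∃ r₀ : ℕ, 1 ≤ r₀ ∧ ∀ r : ℕ, r₀ ≤ r →
      (∀ a : A, (∃ b : B, f a = (2 ^ r : ℕ) • b) →
        ∃ a' : A, a = (2 ^ r : ℕ) • a') ∧
      (∀ b : B, (2 ^ r : ℕ) • b = 0 →
        ∃ a : A, (2 ^ r : ℕ) • a = 0 ∧ f a = b))
    (hQ : Function.Bijective
      (LinearMap.rTensor (R := ℤ) ℚ f.toIntLinearMap)) :
    Odd (Nat.card f.ker) ∧ Odd (Nat.card (B ⧸ f.range)) := by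
  obtain ⟨r₀, hr₀, h⟩ := h
  have : Module.Finite ℤ A := Module.Finite.iff_addGroup_fg.2 ‹_›
  have : Module.Finite ℤ B := Module.Finite.iff_addGroup_fg.2 ‹_›
  constructor
  · have hdiv (a : f.ker) : ∃ c : ℤ, (c * 2) • (a : A) = a :=
      exists_even_smul_eq_self (a : A) r₀ fun r hr ↦ (h r hr).1 a ⟨0, by rw [smul_zero]; exact a.2⟩
    have : Module.Finite ℤ f.ker :=
      inferInstanceAs (Module.Finite ℤ (LinearMap.ker f.toIntLinearMap))
    refine odd_natCard_of_torsion_of_two_torsion_free (fun a ↦ ?_) fun a ha ↦ ?_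
    · obtain ⟨c, hc⟩ := hdiv a
      refine ⟨c * 2 - 1, by lia, Subtype.ext ?_⟩
      simp [sub_smul, hc]
    · obtain ⟨c, hc⟩ := hdiv a
      have ha' : (2 : ℤ) • (a : A) = 0 := by exact_mod_cast congrArg Subtype.val ha
      rw [mul_smul, ha', smul_zero] at hc
      exact Subtype.ext hc.symm
  · have : Module.Finite ℤ (B ⧸ f.range) :=
      Module.Finite.of_surjective (QuotientAddGroup.mk' f.range).toIntLinearMap
        (QuotientAddGroup.mk'_surjective _)
    refine odd_natCard_of_torsion_of_two_torsion_free (fun x ↦ ?_) fun x hx ↦ ?_ <;>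
      obtain ⟨b, rfl⟩ := QuotientAddGroup.mk_surjective x
    · obtain ⟨n, hn, a, ha⟩ := exists_smul_mem_range_of_rTensor_rat_surjective _ hQ.2 b
      refine ⟨n, hn, ?_⟩
      rw [← QuotientAddGroup.mk_zsmul, QuotientAddGroup.eq_zero_iff]
      exact ⟨a, ha⟩
    · rw [← QuotientAddGroup.mk_nsmul, QuotientAddGroup.eq_zero_iff] at hx
      obtain ⟨a, ha⟩ := hx
      obtain ⟨r, rfl⟩ := Nat.exists_eq_add_of_le' hr₀
      obtain ⟨hinj, hsurj⟩ := h (r + 1) le_rfl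
      have hb : f ((2 ^ r : ℕ) • a) = (2 ^ (r + 1) : ℕ) • b := by
        rw [map_nsmul, ha, pow_succ, mul_smul]
      obtain ⟨a', ha'⟩ := hinj _ ⟨b, hb⟩
      obtain ⟨a'', -, ha''⟩ := hsurj (b - f a') (by
        rw [smul_sub, ← hb, ha', map_nsmul, sub_self])
      rw [QuotientAddGroup.eq_zero_iff]
      exact ⟨a' + a'', by simp [ha'']⟩
end
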